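/- arXiv:2201.02275 — 6 statements merged into one kernel-verified Lean document; each statement's English description precedes it below -/
import Mathlib

section
/- Optimal mean square error with a fixed prefilter: if B ∈ ℝ^{L×M} has rank L, then for every D ∈ ℝ^{N×L}, J(D·B) ≥ J(W(B)) = tr(Σ_X) − tr(Σ_XY·Bᵀ·(B·Σ_Y·Bᵀ)⁻¹·B·Σ_XYᵀ), with equality if and only if D·B = W(B). -/
open Matrix

namespace Matrix

variable {m n : Type*} [Fintype m] [Fintype n]

theorem vecMul_injective_of_rank_eq_card {K : Type*} [Field K] {B : Matrix m n K}
    (hB : B.rank = Fintype.card m) : Function.Injective B.vecMul := by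
  rw [vecMul_injective_iff, linearIndependent_iff_card_eq_finrank_span, Set.finrank,
    ← rank_eq_finrank_span_row, hB]

theorem PosDef.trace_mul_mul_transpose_same_nonneg {S : Matrix n n ℝ} (hS : S.PosDef)
    (E : Matrix m n ℝ) : 0 ≤ (E * S * Eᵀ).trace := by
  simpa using (hS.posSemidef.mul_mul_conjTranspose_same E).trace_nonneg

theorem PosDef.trace_mul_mul_transpose_same_eq_zero_iff {S : Matrix n n ℝ} (hS : S.PosDef)
    {E : Matrix m n ℝ} : (E * S * Eᵀ).trace = 0 ↔ E = 0 := by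
  refine ⟨fun h => ?_, fun h => by simp [h]⟩
  have hdiag (i : m) : (E * S * Eᵀ) i i = E.row i ⬝ᵥ S *ᵥ E.row i := by
    rw [dotProduct_mulVec]
    rfl
  have hnonneg (i : m) : 0 ≤ (E * S * Eᵀ) i i := by
    simpa [hdiag] using hS.posSemidef.dotProduct_mulVec_nonneg (E.row i)
  have hzero := (Fintype.sum_eq_zero_iff_of_nonneg hnonneg).1 h
  ext i j
  by_contra hij
  have hpos := hS.dotProduct_mulVec_pos (x := E.row i) fun h => hij (congrFun h j)
  rw [star_trivial, ← hdiag] at hpos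
  exact hpos.ne' (congrFun hzero i)

end Matrix

/-- Optimal mean square error with a fixed prefilter `B` of full row rank: for every `D`,
`J(D·B) ≥ J(W(B)) = tr(C_X) − tr(C_XY Bᵀ (B C_Y Bᵀ)⁻¹ B C_XYᵀ)`, with equality iff
`D·B = W(B)`, where `W(B) = C_XY Bᵀ (B C_Y Bᵀ)⁻¹ B`. -/
theorem opt_mse_fixed_prefilter
    (N M L : ℕ) (hLM : L ≤ M)
    (CX : Matrix (Fin N) (Fin N) ℝ) (CY : Matrix (Fin M) (Fin M) ℝ)
    (CXY : Matrix (Fin N) (Fin M) ℝ)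
    (hX : CX.IsSymm) (hY : CY.PosDef)
    (J : Matrix (Fin N) (Fin M) ℝ → ℝ)
    (hJ : ∀ A, J A = CX.trace - 2 * (A * CXYᵀ).trace + (A * CY * Aᵀ).trace)
    (B : Matrix (Fin L) (Fin M) ℝ) (hB : B.rank = L)
    (W : Matrix (Fin N) (Fin M) ℝ) (hW : W = CXY * Bᵀ * (B * CY * Bᵀ)⁻¹ * B)
    (D : Matrix (Fin N) (Fin L) ℝ) :
    J (D * B) ≥ J W ∧
    J W = CX.trace - (CXY * Bᵀ * (B * CY * Bᵀ)⁻¹ * B * CXYᵀ).trace ∧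
    (J (D * B) = J W ↔ D * B = W) := by
  set G := B * CY * Bᵀ with hG
  set K := CXY * Bᵀ * G⁻¹ with hK
  have hGpos : G.PosDef := by
    simpa using hY.mul_mul_conjTranspose_same
      (vecMul_injective_of_rank_eq_card (hB.trans (Fintype.card_fin L).symm))
  have hGsymm : Gᵀ = G := by simpa using hGpos.isHermitian.eq
  have hKG : K * G = CXY * Bᵀ := by
    rw [hK, Matrix.mul_assoc, nonsing_inv_mul _ ((isUnit_iff_isUnit_det G).1 hGpos.isUnit),
      Matrix.mul_one]
  have hBX : B * CXYᵀ = G * Kᵀ := by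
    simpa [transpose_mul, hGsymm] using (congrArg transpose hKG).symm
  have hquad (A : Matrix (Fin N) (Fin L) ℝ) : A * B * CY * (A * B)ᵀ = A * G * Aᵀ := by
    simp only [hG, transpose_mul, Matrix.mul_assoc]
  have hcross : (K * G * Dᵀ).trace = (D * G * Kᵀ).trace := by
    rw [← trace_transpose]
    simp only [transpose_mul, transpose_transpose, hGsymm, Matrix.mul_assoc]
  have hJB (A : Matrix (Fin N) (Fin L) ℝ) :
      J (A * B) = CX.trace - 2 * (A * G * Kᵀ).trace + (A * G * Aᵀ).trace := by
    rw [hJ, hquad, Matrix.mul_assoc A B, hBX, ← Matrix.mul_assoc A G]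
  have hexcess : J (D * B) = J W + ((D * B - W) * CY * (D * B - W)ᵀ).trace := by
    rw [hW, ← Matrix.sub_mul, hquad, hJB, hJB]
    simp only [Matrix.sub_mul, Matrix.mul_sub, transpose_sub, trace_sub, hcross]
    ring
  refine ⟨?_, ?_, ?_⟩
  · rw [hexcess]
    exact le_add_of_nonneg_right (hY.trace_mul_mul_transpose_same_nonneg _)
  · rw [hW, hJB, Matrix.mul_assoc K B, hBX, ← Matrix.mul_assoc K G]
    ring
  · rw [hexcess, add_eq_left, hY.trace_mul_mul_transpose_same_eq_zero_iff, sub_eq_zero]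
end

section
/- Determinant optimality of the Wiener filter: if the joint covariance matrix [[Σ_X, Σ_XY],[Σ_XYᵀ, Σ_Y]] ∈ ℝ^{(N+M)×(N+M)} is positive semidefinite and Σ_Y is positive definite, then for every A ∈ ℝ^{N×M}, det(Σ_err(A)) ≥ det(Σ_err(A_W)). -/
open Matrix

namespace Matrix

/-- Adding a positive semidefinite matrix to the identity does not decrease the determinant. -/
theorem PosSemidef.one_le_det_one_add {n : Type*} [Fintype n] [DecidableEq n]
    {Q : Matrix n n ℝ} (hQ : Q.PosSemidef) : 1 ≤ (1 + Q).det := by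
  set U := hQ.1.eigenvectorUnitary
  have hdet : (1 + Q).det = ∏ i, (1 + hQ.1.eigenvalues i) := by
    have h : 1 + Q = Unitary.conjStarAlgAut ℝ _ U
        (diagonal fun i => 1 + hQ.1.eigenvalues i) := by
      conv_lhs => rw [hQ.1.spectral_theorem]
      rw [← map_one (Unitary.conjStarAlgAut ℝ _ U), ← map_add, ← diagonal_one, diagonal_add]
      rfl
    simp only [h, det_map, det_diagonal]
  rw [hdet]
  exact Finset.one_le_prod fun i _ => by linarith [hQ.eigenvalues_nonneg i]

open scoped MatrixOrder in
/-- The determinant is monotone on positive semidefinite matrices. -/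
theorem PosSemidef.det_le_det_add {n : Type*} [Fintype n] [DecidableEq n]
    {S P : Matrix n n ℝ} (hS : S.PosSemidef) (hP : P.PosSemidef) : S.det ≤ (S + P).det := by
  by_cases h0 : S.det = 0
  · rw [h0]
    exact (hS.add hP).det_nonneg
  · obtain ⟨B, rfl⟩ := CStarAlgebra.nonneg_iff_eq_star_mul_self.mp hP.nonneg
    rw [det_add_mul _ _ (isUnit_iff_ne_zero.mpr h0)]
    exact le_mul_of_one_le_right hS.det_nonneg
      (hS.inv.mul_mul_conjTranspose_same B).one_le_det_one_add

end Matrix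

/-- Determinant optimality of the Wiener filter: if the joint covariance matrix
`[[C_X, C_XY],[C_XYᵀ, C_Y]]` is positive semidefinite and `C_Y` is positive definite, then
for every `A`, `det(Σ_err(A)) ≥ det(Σ_err(A_W))`. -/
theorem wiener_det_optimality
    (N M : ℕ)
    (CX : Matrix (Fin N) (Fin N) ℝ) (CY : Matrix (Fin M) (Fin M) ℝ)
    (CXY : Matrix (Fin N) (Fin M) ℝ)
    (hX : CX.IsSymm) (hY : CY.PosDef)
    (hjoint : (Matrix.fromBlocks CX CXY CXYᵀ CY).PosSemidef)
    (Cerr : Matrix (Fin N) (Fin M) ℝ → Matrix (Fin N) (Fin N) ℝ)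
    (hCerr : ∀ A, Cerr A = CX - A * CXYᵀ - CXY * Aᵀ + A * CY * Aᵀ)
    (AW : Matrix (Fin N) (Fin M) ℝ) (hAW : AW = CXY * CY⁻¹)
    (A : Matrix (Fin N) (Fin M) ℝ) :
    (Cerr A).det ≥ (Cerr AW).det := by
  have hu : IsUnit CY.det := (isUnit_iff_isUnit_det CY).mp hY.isUnit
  let := CY.invertibleOfIsUnitDet hu
  have hsymm : CYᵀ = CY := by simpa using hY.isHermitian.eq
  have hAWmul : AW * CY = CXY := by rw [hAW, nonsing_inv_mul_cancel_right _ _ hu]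
  have hmulAWT : CY * AWᵀ = CXYᵀ := by rw [← hAWmul, transpose_mul, hsymm]
  have hcross : AW * CXYᵀ = CXY * AWᵀ := by rw [← hmulAWT, ← Matrix.mul_assoc, hAWmul]
  have hmin : Cerr AW = CX - CXY * CY⁻¹ * CXYᵀ := by
    rw [hCerr, hAWmul, ← hAW]
    abel
  have hdecomp : Cerr A = Cerr AW + (A - AW) * CY * (A - AW)ᴴ := by
    rw [hCerr, hCerr, conjTranspose_eq_transpose_of_trivial, transpose_sub, Matrix.sub_mul,
      hAWmul, Matrix.sub_mul, Matrix.mul_sub, Matrix.mul_sub,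
      Matrix.mul_assoc A CY AWᵀ, hmulAWT, hcross]
    abel
  have hS : (Cerr AW).PosSemidef := by
    rw [hmin]
    simpa using (PosDef.fromBlocks₂₂ CX CXY hY).mp (by simpa using hjoint)
  rw [ge_iff_le, hdecomp]
  exact hS.det_le_det_add (hY.posSemidef.mul_mul_conjTranspose_same _)
end

section
/- Optimal value of the rank-constrained LMMSE problem (low-rank Wiener filter): for every L ∈ ℕ, the minimum of J(A) over all A ∈ ℝ^{N×M} with rank(A) ≤ L is attained and equals tr(Σ_X) − Σ_{i=1}^{min(L,N)} λ_i, where λ_1 ≥ λ_2 ≥ … ≥ λ_N are the eigenvalues of the symmetric positive semidefinite matrix Σ_XY·Σ_Y⁻¹·Σ_XYᵀ listed in decreasing order. -/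
open Matrix

namespace Matrix

variable {n m : Type*} [Fintype n] [Fintype m]

/-- The orthogonal projection onto the column space of a real matrix `A`: a symmetric idempotent
that fixes `A` and whose trace is the rank of `A`. -/
lemma exists_isSymm_mul_self_eq_trace_eq_rank [DecidableEq n] (A : Matrix n m ℝ) :
    ∃ P : Matrix n n ℝ, P.IsSymm ∧ P * P = P ∧ P * A = A ∧ P.trace = A.rank := by
  have hA : (A * Aᵀ).IsHermitian := isHermitian_mul_conjTranspose_self A
  obtain ⟨V, e, hV, hS, hr⟩ : ∃ (V : Matrix n n ℝ) (e : n → ℝ), Vᵀ * V = 1 ∧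
      A * Aᵀ = V * diagonal e * Vᵀ ∧ A.rank = Fintype.card {i // e i ≠ 0} := by
    refine ⟨hA.eigenvectorUnitary, hA.eigenvalues, ?_, ?_, ?_⟩
    · exact Unitary.coe_star_mul_self hA.eigenvectorUnitary
    · exact hA.spectral_theorem
    · rw [← hA.rank_eq_card_non_zero_eigs, rank_self_mul_transpose]
  have hcancel (X : Matrix n n ℝ) : Vᵀ * (V * X) = X := by rw [← Matrix.mul_assoc, hV, one_mul]
  set E : Matrix n n ℝ := diagonal fun i => if e i ≠ 0 then 1 else 0
  have hEE : E * E = E := by simp [E]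
  have hEe : E * diagonal e = diagonal e := by simp +contextual [E]
  refine ⟨V * E * Vᵀ, ?_, ?_, ?_, ?_⟩
  · simp [IsSymm, E, Matrix.mul_assoc]
  · simp only [Matrix.mul_assoc, hcancel]
    rw [← Matrix.mul_assoc E E, hEE]
  · have h : (V * E * Vᵀ - 1) * (A * Aᴴ) = 0 := by
      rw [conjTranspose_eq_transpose_of_trivial, Matrix.sub_mul, hS]
      simp only [Matrix.mul_assoc, hcancel, one_mul]
      rw [← Matrix.mul_assoc E, hEe, sub_self]
    rw [mul_self_mul_conjTranspose_eq_zero, Matrix.sub_mul, Matrix.one_mul] at h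
    exact sub_eq_zero.mp h
  · rw [trace_mul_cycle, hV, one_mul, hr, Fintype.card_subtype]
    simp only [E, trace_diagonal, Finset.sum_boole]

/-- The diagonal entries of a symmetric idempotent real matrix lie in `[0, 1]`. -/
lemma diag_mem_Icc_of_isSymm_of_mul_self {Q : Matrix n n ℝ} (hQ : Q.IsSymm) (hQQ : Q * Q = Q)
    (i : n) : Q i i ∈ Set.Icc (0 : ℝ) 1 := by
  have h : Q i i = ∑ j, Q i j ^ 2 := by
    conv_lhs => rw [← hQQ, mul_apply]
    exact Finset.sum_congr rfl fun j _ => by rw [hQ.apply, sq]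
  have hle : Q i i ^ 2 ≤ Q i i := by
    conv_rhs => rw [h]
    exact Finset.single_le_sum (f := fun j => Q i j ^ 2) (fun j _ => sq_nonneg _)
      (Finset.mem_univ i)
  constructor <;> nlinarith

/-- Completing the square in the linear estimation error, within the column space of a
projection `P`. -/
lemma trace_quadratic_sub_eq_of_isSymm_of_mul_self [DecidableEq m] {P : Matrix n n ℝ}
    {A C : Matrix n m ℝ} {S : Matrix m m ℝ} (hP : P.IsSymm) (hPP : P * P = P) (hPA : P * A = A)
    (hS : S.PosDef) :
    (A * S * Aᵀ).trace - 2 * (A * Cᵀ).trace =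
      ((A - P * C * S⁻¹) * S * (A - P * C * S⁻¹)ᵀ).trace - (P * (C * S⁻¹ * Cᵀ)).trace := by
  have hdet : IsUnit S.det := (isUnit_iff_isUnit_det S).mp hS.isUnit
  have hSt : Sᵀ = S := hS.isHermitian
  have hcross : (P * C * Aᵀ).trace = (A * Cᵀ).trace := by
    rw [← trace_transpose (P * C * Aᵀ)]
    simp only [transpose_mul, transpose_transpose, hP.eq]
    rw [← Matrix.mul_assoc, trace_mul_comm, ← Matrix.mul_assoc, hPA]
  have hcross' : (A * (Cᵀ * P)).trace = (A * Cᵀ).trace := by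
    rw [← Matrix.mul_assoc, trace_mul_comm, ← Matrix.mul_assoc, hPA]
  have hproj : (P * (C * S⁻¹ * Cᵀ) * P).trace = (P * (C * S⁻¹ * Cᵀ)).trace := by
    rw [trace_mul_comm, ← Matrix.mul_assoc, hPP]
  have hmul : (A - P * C * S⁻¹) * S = A * S - P * C := by
    rw [Matrix.sub_mul, nonsing_inv_mul_cancel_right _ _ hdet]
  have htr : (A - P * C * S⁻¹)ᵀ = Aᵀ - S⁻¹ * (Cᵀ * P) := by
    simp [transpose_nonsing_inv, hSt, hP.eq]
  have hexp : (A * S - P * C) * (Aᵀ - S⁻¹ * (Cᵀ * P)) =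
      A * S * Aᵀ - A * (Cᵀ * P) - (P * C * Aᵀ - P * (C * S⁻¹ * Cᵀ) * P) := by
    rw [Matrix.sub_mul, Matrix.mul_sub, Matrix.mul_sub, Matrix.mul_assoc A S (S⁻¹ * _),
      mul_nonsing_inv_cancel_left _ _ hdet]
    simp only [Matrix.mul_assoc]
  rw [hmul, htr, hexp, trace_sub, trace_sub, trace_sub, hcross, hcross', hproj]
  ring

end Matrix

/-- A weighted sum of decreasing nonnegative numbers, with weights in `[0, 1]` of total mass at
most `L`, is at most the sum of the first `L` of them. -/
lemma sum_mul_le_sum_ite_lt_of_antitone {N L : ℕ} {lam q : Fin N → ℝ} (hlam : Antitone lam)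
    (hnonneg : ∀ i, 0 ≤ lam i) (hq : ∀ i, q i ∈ Set.Icc (0 : ℝ) 1) (hsum : ∑ i, q i ≤ L) :
    ∑ i, q i * lam i ≤ ∑ i : Fin N, if (i : ℕ) < L then lam i else 0 := by
  rcases le_or_gt N L with hNL | hLN
  · refine Finset.sum_le_sum fun i _ => ?_
    rw [if_pos (i.isLt.trans_le hNL)]
    exact mul_le_of_le_one_left (hnonneg i) (hq i).2
  · set t := lam ⟨L, hLN⟩
    have hcard : ∑ i : Fin N, (if (i : ℕ) < L then (1 : ℝ) else 0) = L := by
      rw [Finset.sum_boole, Fin.card_filter_val_lt, min_eq_right hLN.le]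
    have hterm (i : Fin N) : q i * lam i - t * q i ≤
        (if (i : ℕ) < L then lam i else 0) - t * (if (i : ℕ) < L then (1 : ℝ) else 0) := by
      obtain ⟨h0, h1⟩ := hq i
      split_ifs with hi
      · have : t ≤ lam i := hlam (Fin.le_def.mpr hi.le)
        nlinarith
      · have : lam i ≤ t := hlam (Fin.le_def.mpr (not_lt.mp hi))
        nlinarith
    have h := Finset.sum_le_sum fun i (_ : i ∈ Finset.univ) => hterm i
    simp only [Finset.sum_sub_distrib, ← Finset.mul_sum, hcard] at h
    nlinarith [mul_le_mul_of_nonneg_left hsum (hnonneg ⟨L, hLN⟩)]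

/-- Optimal value of the rank-constrained LMMSE problem (low-rank Wiener filter): the minimum
of `J(A)` over all `A` with `rank(A) ≤ L` is attained and equals
`tr(C_X) − ∑_{i=1}^{min(L,N)} λ_i`, where `λ_1 ≥ … ≥ λ_N` are the decreasing eigenvalues of
the positive semidefinite matrix `C_XY C_Y⁻¹ C_XYᵀ`. -/
theorem low_rank_wiener_optimal_value
    (N M : ℕ)
    (CX : Matrix (Fin N) (Fin N) ℝ) (CY : Matrix (Fin M) (Fin M) ℝ)
    (CXY : Matrix (Fin N) (Fin M) ℝ)
    (hX : CX.IsSymm) (hY : CY.PosDef)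
    (J : Matrix (Fin N) (Fin M) ℝ → ℝ)
    (hJ : ∀ A, J A = CX.trace - 2 * (A * CXYᵀ).trace + (A * CY * Aᵀ).trace)
    (lam : Fin N → ℝ) (U : Matrix (Fin N) (Fin N) ℝ)
    (hU : U * Uᵀ = 1 ∧ Uᵀ * U = 1)
    (hdiag : CXY * CY⁻¹ * CXYᵀ = U * Matrix.diagonal lam * Uᵀ)
    (hdec : ∀ i j : Fin N, i ≤ j → lam j ≤ lam i)
    (L : ℕ) :
    IsLeast {x : ℝ | ∃ A : Matrix (Fin N) (Fin M) ℝ, A.rank ≤ L ∧ x = J A}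
      (CX.trace - ∑ i : Fin N, if (i : ℕ) < L then lam i else 0) := by
  set S := CXY * CY⁻¹ * CXYᵀ
  have htrace (P : Matrix (Fin N) (Fin N) ℝ) :
      (P * S).trace = ∑ i, (Uᵀ * P * U) i i * lam i := by
    rw [hdiag, ← Matrix.mul_assoc, trace_mul_comm, ← Matrix.mul_assoc, ← Matrix.mul_assoc]
    simp [trace, mul_diagonal]
  have hnonneg (i : Fin N) : 0 ≤ lam i := by
    have hS : S.PosSemidef := hY.inv.posSemidef.mul_mul_conjTranspose_same CXY
    have hD : Uᵀ * S * U = diagonal lam := by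
      rw [hdiag, ← Matrix.mul_assoc, ← Matrix.mul_assoc, hU.2, one_mul, Matrix.mul_assoc, hU.2,
        mul_one]
    have h : (Uᵀ * S * U).PosSemidef := hS.conjTranspose_mul_mul_same U
    simpa [hD] using h.diag_nonneg (i := i)
  constructor
  · set E : Matrix (Fin N) (Fin N) ℝ := diagonal fun i => if (i : ℕ) < L then 1 else 0
    have hEE : E * E = E := by simp [E]
    have hcancel (X : Matrix (Fin N) (Fin N) ℝ) : Uᵀ * (U * X) = X := by
      rw [← Matrix.mul_assoc, hU.2, one_mul]
    have hP : (U * E * Uᵀ).IsSymm := by simp [IsSymm, E, Matrix.mul_assoc]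
    have hPP : U * E * Uᵀ * (U * E * Uᵀ) = U * E * Uᵀ := by
      simp only [Matrix.mul_assoc, hcancel]
      rw [← Matrix.mul_assoc E E, hEE]
    refine ⟨U * E * Uᵀ * CXY * CY⁻¹, ?_, ?_⟩
    · have hE : E.rank ≤ L := by
        rw [rank_diagonal, Fintype.card_subtype]
        simp [Fin.card_filter_val_lt]
      exact (rank_mul_le_left _ _).trans <| (rank_mul_le_left _ _).trans <|
        (rank_mul_le_left _ _).trans <| (rank_mul_le_right _ _).trans hE
    · have hsq := trace_quadratic_sub_eq_of_isSymm_of_mul_self (C := CXY)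
        (A := U * E * Uᵀ * CXY * CY⁻¹) hP hPP
        (by rw [← Matrix.mul_assoc, ← Matrix.mul_assoc, hPP]) hY
      have hQ : Uᵀ * (U * E * Uᵀ) * U = E := by
        simp only [Matrix.mul_assoc, hcancel, hU.2, mul_one]
      have hPS := htrace (U * E * Uᵀ)
      rw [hQ] at hPS
      simp only [E, diagonal_apply_eq, ite_mul, one_mul, zero_mul] at hPS
      rw [sub_self, Matrix.zero_mul, Matrix.zero_mul, trace_zero] at hsq
      rw [hJ, ← hPS]
      linarith
  · rintro _ ⟨A, hA, rfl⟩
    obtain ⟨P, hP, hPP, hPA, hPr⟩ := A.exists_isSymm_mul_self_eq_trace_eq_rank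
    have hsq := trace_quadratic_sub_eq_of_isSymm_of_mul_self (C := CXY) hP hPP hPA hY
    have hpos : 0 ≤ ((A - P * CXY * CY⁻¹) * CY * (A - P * CXY * CY⁻¹)ᵀ).trace :=
      (hY.posSemidef.mul_mul_conjTranspose_same (A - P * CXY * CY⁻¹)).trace_nonneg
    have hQ : (Uᵀ * P * U).IsSymm := by simp [IsSymm, hP.eq, Matrix.mul_assoc]
    have hQQ : Uᵀ * P * U * (Uᵀ * P * U) = Uᵀ * P * U := by
      calc Uᵀ * P * U * (Uᵀ * P * U) = Uᵀ * P * (U * Uᵀ) * P * U := by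
            simp only [Matrix.mul_assoc]
        _ = Uᵀ * P * U := by rw [hU.1, mul_one, Matrix.mul_assoc Uᵀ P P, hPP]
    have hsum : ∑ i, (Uᵀ * P * U) i i ≤ L := by
      change (Uᵀ * P * U).trace ≤ L
      rw [trace_mul_cycle, hU.1, one_mul, hPr]
      exact_mod_cast hA
    have hle := sum_mul_le_sum_ite_lt_of_antitone (fun i j h => hdec i j h) hnonneg
      (diag_mem_Icc_of_isSymm_of_mul_self hQ hQQ) hsum
    rw [← htrace] at hle
    rw [hJ]
    linarith
end

section
/- Convergence of the low-rank Wiener filter to the Wiener filter with scaling law O(ρ_L): for every L ∈ ℕ there exists A ∈ ℝ^{N×M} with rank(A) ≤ L that minimizes J over matrices of rank at most L and satisfies ‖A_W − A‖ ≤ ρ_L·‖Σ_Y^{−1/2}‖, where ‖·‖ is the operator norm, ρ_L := Σ_{i>L} σ_i is the sum of all but the L largest singular values of Φ := Σ_XY·Σ_Y^{−1/2} (the singular values σ_1 ≥ σ_2 ≥ … being the square roots of the decreasing eigenvalues of Φ·Φᵀ), and A_W = Σ_XY·Σ_Y⁻¹. -/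
open Matrix

/-- The `ℓ²`-operator norm of a real matrix. -/
noncomputable def opNorm {m n : Type*} [Fintype m] [Fintype n] [DecidableEq n]
    (A : Matrix m n ℝ) : ℝ :=
  ‖(Matrix.toEuclideanLin A).toContinuousLinearMap‖

/-- The operator norm is bounded by the Frobenius norm. -/
theorem opNorm_le_of_trace_le {m n : Type*} [Fintype m] [Fintype n] [DecidableEq n]
    (A : Matrix m n ℝ) {c : ℝ} (hc : 0 ≤ c) (h : (A * Aᵀ).trace ≤ c ^ 2) : opNorm A ≤ c := by
  refine ContinuousLinearMap.opNorm_le_bound _ hc fun v => ?_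
  have hv : 0 ≤ ‖v‖ := norm_nonneg v
  refine le_of_sq_le_sq ?_ (by positivity)
  rw [mul_pow, EuclideanSpace.norm_sq_eq, EuclideanSpace.norm_sq_eq]
  simp only [Real.norm_eq_abs, sq_abs]
  calc _ ≤ ∑ i, (∑ j, A i j ^ 2) * ∑ j, v j ^ 2 :=
        Finset.sum_le_sum fun i _ => Finset.sum_mul_sq_le_sq_mul_sq _ _ _
    _ = (A * Aᵀ).trace * ∑ j, v j ^ 2 := by
        rw [← Finset.sum_mul]
        simp [trace, mul_apply, sq]
    _ ≤ _ := by gcongr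

theorem opNorm_nonneg {m n : Type*} [Fintype m] [Fintype n] [DecidableEq n]
    (A : Matrix m n ℝ) : 0 ≤ opNorm A := norm_nonneg _

theorem opNorm_mul_le {l m n : Type*} [Fintype l] [Fintype m] [Fintype n] [DecidableEq m]
    [DecidableEq n] (A : Matrix l m ℝ) (B : Matrix m n ℝ) :
    opNorm (A * B) ≤ opNorm A * opNorm B := by
  have h : (toEuclideanLin (A * B)).toContinuousLinearMap =
      (toEuclideanLin A).toContinuousLinearMap.comp
        (toEuclideanLin B).toContinuousLinearMap := by
    ext v : 1
    simp [toEuclideanLin, toLpLin_apply, mulVec_mulVec]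
  unfold opNorm
  rw [h]
  exact ContinuousLinearMap.opNorm_comp_le _ _

/-- A matrix factors through an orthonormal frame of its column space. -/
theorem exists_orthonormal_frame {m n : Type*} [Fintype m] [Fintype n] [DecidableEq n]
    (B : Matrix m n ℝ) :
    ∃ V : Matrix m (Fin B.rank) ℝ, Vᵀ * V = 1 ∧ V * Vᵀ * B = B := by
  let K := LinearMap.range (toEuclideanLin B)
  have hK : Module.finrank ℝ K = B.rank := (B.rank_eq_finrank_range_toLin
    (EuclideanSpace.basisFun m ℝ).toBasis (EuclideanSpace.basisFun n ℝ).toBasis).symm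
  let b : OrthonormalBasis (Fin B.rank) ℝ K :=
    (stdOrthonormalBasis ℝ K).reindex (finCongr hK)
  let V : Matrix m (Fin B.rank) ℝ := Matrix.of fun i k => (b k : EuclideanSpace ℝ m) i
  refine ⟨V, ?_, ?_⟩
  · ext k l
    have h := (orthonormal_iff_ite.mp b.orthonormal) k l
    rw [Submodule.coe_inner, PiLp.inner_apply] at h
    rw [mul_apply, one_apply]
    exact (Finset.sum_congr rfl fun i _ => mul_comm _ _).trans h
  · ext i j
    have hcol : WithLp.toLp 2 (B.col j) ∈ K :=
      ⟨EuclideanSpace.single j 1, by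
        simp [toEuclideanLin, toLpLin_apply]⟩
    have h := congrArg (fun x : K => (x : EuclideanSpace ℝ m) i)
      (b.sum_repr' ⟨_, hcol⟩)
    simp only [Submodule.coe_inner, PiLp.inner_apply, Submodule.coe_sum, Submodule.coe_smul,
      WithLp.ofLp_sum, Finset.sum_apply, PiLp.smul_apply, smul_eq_mul, col_apply] at h
    rw [Matrix.mul_assoc, mul_apply, ← h]
    refine Finset.sum_congr rfl fun k _ => ?_
    rw [mul_comm, mul_apply]
    congr 1
    exact Finset.sum_congr rfl fun l _ => mul_comm _ _

/-- A weighted sum of a decreasing sequence with weights in `[0, 1]` of total mass at most `L` is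
at most the sum of the first `L` terms. -/
theorem sum_mul_le_sum_initial {N L : ℕ} (s q : Fin N → ℝ) (hs : ∀ i, 0 ≤ s i)
    (hdec : ∀ i j, i ≤ j → s j ≤ s i) (hq0 : ∀ i, 0 ≤ q i) (hq1 : ∀ i, q i ≤ 1)
    (hq : ∑ i, q i ≤ L) :
    ∑ i, q i * s i ≤ ∑ i : Fin N, if L ≤ (i : ℕ) then 0 else s i := by
  rcases le_or_gt N L with hL | hL
  · refine Finset.sum_le_sum fun i _ => ?_
    rw [if_neg (by omega)]
    exact mul_le_of_le_one_left (hs i) (hq1 i)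
  · have hcard : ∑ i : Fin N, (if L ≤ (i : ℕ) then (0 : ℝ) else 1) = L := by
      have h := Fin.card_filter_val_lt (n := N) (m := L)
      simp only [← not_lt, ite_not, Finset.sum_boole]
      rw [h, min_eq_right hL.le]
    have hterm : ∀ i : Fin N, q i * s i - (if L ≤ (i : ℕ) then 0 else s i) ≤
        s ⟨L, hL⟩ * (q i - if L ≤ (i : ℕ) then 0 else 1) := by
      intro i
      split_ifs with h
      · have := mul_le_mul_of_nonneg_left (hdec ⟨L, hL⟩ i h) (hq0 i)
        linarith
      · have := hdec i ⟨L, hL⟩ (by simp [Fin.le_def]; omega)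
        nlinarith [hq1 i]
    have hsum := Finset.sum_le_sum fun i (_ : i ∈ Finset.univ) => hterm i
    rw [Finset.sum_sub_distrib, ← Finset.mul_sum, Finset.sum_sub_distrib, hcard] at hsum
    nlinarith [hs ⟨L, hL⟩]

theorem trace_mul_transpose_nonneg {m n : Type*} [Fintype m] [Fintype n] (A : Matrix m n ℝ) :
    0 ≤ (A * Aᵀ).trace := by
  simp only [trace, diag_apply, mul_apply, transpose_apply]
  exact Finset.sum_nonneg fun i _ => Finset.sum_nonneg fun j _ => mul_self_nonneg _

/-- The diagonal entries of `W Wᵀ` for a matrix `W` with orthonormal columns lie in `[0, 1]`. -/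
theorem diag_mul_transpose_mem_Icc {m n : Type*} [Fintype m] [Fintype n] [DecidableEq n]
    {W : Matrix m n ℝ} (hW : Wᵀ * W = 1) (i : m) : (W * Wᵀ) i i ∈ Set.Icc (0 : ℝ) 1 := by
  have hidem : (W * Wᵀ) * (W * Wᵀ)ᵀ = W * Wᵀ := by
    rw [transpose_mul, transpose_transpose, Matrix.mul_assoc, ← Matrix.mul_assoc Wᵀ, hW,
      Matrix.one_mul]
  have h : ∑ j, (W * Wᵀ) i j ^ 2 = (W * Wᵀ) i i := by
    conv_rhs => rw [← hidem, mul_apply]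
    simp [sq]
  have h0 : 0 ≤ (W * Wᵀ) i i := h ▸ Finset.sum_nonneg fun j _ => sq_nonneg _
  have h1 : (W * Wᵀ) i i ^ 2 ≤ (W * Wᵀ) i i := by
    conv_rhs => rw [← h]
    exact Finset.single_le_sum (f := fun j => (W * Wᵀ) i j ^ 2)
      (fun j _ => sq_nonneg _) (Finset.mem_univ i)
  exact ⟨h0, by nlinarith⟩

/-- The lower bound in the Eckart–Young theorem for the Frobenius norm. -/
theorem sum_tail_le_trace_sub {N L : ℕ} {n : Type*} [Fintype n] [DecidableEq n]
    {Φ : Matrix (Fin N) n ℝ} {s : Fin N → ℝ} (hs : ∀ i, 0 ≤ s i)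
    (hdec : ∀ i j, i ≤ j → s j ≤ s i) {U : Matrix (Fin N) (Fin N) ℝ} (hU : U * Uᵀ = 1)
    (hdiag : Φ * Φᵀ = U * diagonal s * Uᵀ) {B : Matrix (Fin N) n ℝ} (hB : B.rank ≤ L) :
    ∑ i : Fin N, (if L ≤ (i : ℕ) then s i else 0) ≤ ((Φ - B) * (Φ - B)ᵀ).trace := by
  have hU' : Uᵀ * U = 1 := mul_eq_one_comm.mp hU
  obtain ⟨V, hV, hVB⟩ := exists_orthonormal_frame B
  have hW : (Uᵀ * V)ᵀ * (Uᵀ * V) = 1 := by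
    rw [transpose_mul, transpose_transpose, Matrix.mul_assoc, ← Matrix.mul_assoc U, hU,
      Matrix.one_mul, hV]
  have hq := diag_mul_transpose_mem_Icc hW
  have htr : ∑ i, ((Uᵀ * V) * (Uᵀ * V)ᵀ) i i ≤ L := by
    change ((Uᵀ * V) * (Uᵀ * V)ᵀ).trace ≤ L
    rw [trace_mul_comm, hW]
    simpa using hB
  have hmain := sum_mul_le_sum_initial s _ hs hdec (fun i => (hq i).1) (fun i => (hq i).2) htr
  have hΦ : (V * Vᵀ * (Φ * Φᵀ)).trace = ∑ i, ((Uᵀ * V) * (Uᵀ * V)ᵀ) i i * s i := by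
    have : (V * Vᵀ * (Φ * Φᵀ)).trace = ((Uᵀ * V) * (Uᵀ * V)ᵀ * diagonal s).trace := by
      rw [hdiag, ← Matrix.mul_assoc, trace_mul_comm]
      simp only [transpose_mul, transpose_transpose, Matrix.mul_assoc]
    rw [this]
    simp [trace, mul_diagonal]
  have htotal : (Φ * Φᵀ).trace = ∑ i, s i := by
    rw [hdiag, trace_mul_comm, ← Matrix.mul_assoc, hU', Matrix.one_mul, trace_diagonal]
  have hsplit : ∑ i : Fin N, (if L ≤ (i : ℕ) then s i else 0) +
      ∑ i : Fin N, (if L ≤ (i : ℕ) then 0 else s i) = ∑ i, s i := by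
    rw [← Finset.sum_add_distrib]
    exact Finset.sum_congr rfl fun i _ => by split_ifs <;> simp
  have hBV : Bᵀ * (V * Vᵀ) = Bᵀ := by
    have := congrArg transpose hVB
    simpa [transpose_mul, Matrix.mul_assoc] using this
  have hpyth : ((Φ - B) * (Φ - B)ᵀ).trace =
      (Φ * Φᵀ).trace - (V * Vᵀ * (Φ * Φᵀ)).trace
        + ((Vᵀ * (Φ - B)) * (Vᵀ * (Φ - B))ᵀ).trace := by
    have h1 : ((Vᵀ * (Φ - B)) * (Vᵀ * (Φ - B))ᵀ).trace =
        (V * Vᵀ * ((Φ - B) * (Φ - B)ᵀ)).trace := by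
      rw [transpose_mul, transpose_transpose, ← Matrix.mul_assoc, trace_mul_comm]
      simp only [Matrix.mul_assoc]
    have h2 : (V * Vᵀ * Φ * Bᵀ).trace = (Φ * Bᵀ).trace := by
      rw [Matrix.mul_assoc (V * Vᵀ), trace_mul_comm, Matrix.mul_assoc, hBV]
    rw [h1]
    simp only [transpose_sub, Matrix.mul_sub, Matrix.sub_mul, trace_sub,
      ← Matrix.mul_assoc, hVB, h2]
    ring
  have := trace_mul_transpose_nonneg (Vᵀ * (Φ - B))
  linarith

/-- Convergence of the low-rank Wiener filter to the Wiener filter with scaling law `O(ρ_L)`: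
for every `L` there is a rank-`≤ L` minimizer `A` of `J` over matrices of rank at most `L`
with `‖A_W − A‖ ≤ ρ_L · ‖C_Y^{−1/2}‖`, where `ρ_L` is the sum of all but the `L` largest
singular values of `Φ = C_XY C_Y^{−1/2}` (the singular values `σ₁ ≥ σ₂ ≥ …` being the square
roots of the decreasing eigenvalues of `Φ Φᵀ`), and `A_W = C_XY C_Y⁻¹`. -/
theorem low_rank_wiener_convergence
    (N M : ℕ)
    (CX : Matrix (Fin N) (Fin N) ℝ) (CY : Matrix (Fin M) (Fin M) ℝ)
    (CXY : Matrix (Fin N) (Fin M) ℝ)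
    (hX : CX.IsSymm) (hY : CY.PosDef)
    (J : Matrix (Fin N) (Fin M) ℝ → ℝ)
    (hJ : ∀ A, J A = CX.trace - 2 * (A * CXYᵀ).trace + (A * CY * Aᵀ).trace)
    (S : Matrix (Fin M) (Fin M) ℝ) (hS : S.PosDef) (hSS : S * S = CY)
    (σ : Fin N → ℝ) (hσ : ∀ i, 0 ≤ σ i)
    (hdec : ∀ i j : Fin N, i ≤ j → σ j ≤ σ i)
    (U : Matrix (Fin N) (Fin N) ℝ) (hU : U * Uᵀ = 1 ∧ Uᵀ * U = 1)
    (hdiag : (CXY * S⁻¹) * (CXY * S⁻¹)ᵀ = U * Matrix.diagonal (fun i => σ i ^ 2) * Uᵀ)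
    (L : ℕ) :
    ∃ A : Matrix (Fin N) (Fin M) ℝ, A.rank ≤ L ∧
      (∀ A' : Matrix (Fin N) (Fin M) ℝ, A'.rank ≤ L → J A ≤ J A') ∧
      opNorm (CXY * CY⁻¹ - A)
        ≤ (∑ i : Fin N, if L ≤ (i : ℕ) then σ i else 0) * opNorm S⁻¹ := by
  have hSu : IsUnit S.det := hS.det_pos.ne'.isUnit
  have hST : Sᵀ = S := by simpa using hS.isHermitian.eq
  set Φ := CXY * S⁻¹ with hΦ
  have hΦS : Φ * S = CXY := nonsing_inv_mul_cancel_right _ _ hSu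
  have hJF : ∀ A, J A = CX.trace - (Φ * Φᵀ).trace + ((Φ - A * S) * (Φ - A * S)ᵀ).trace := by
    intro A
    have h1 : A * CXYᵀ = A * S * Φᵀ := by
      rw [← hΦS, transpose_mul, hST, Matrix.mul_assoc]
    have h2 : A * CY * Aᵀ = A * S * (A * S)ᵀ := by
      rw [← hSS, transpose_mul, hST]
      simp only [Matrix.mul_assoc]
    have h3 : (Φ * (A * S)ᵀ).trace = (A * S * Φᵀ).trace := by
      rw [← trace_transpose, transpose_mul, transpose_transpose]
    rw [hJ, h1, h2, transpose_sub, Matrix.sub_mul, Matrix.mul_sub, Matrix.mul_sub]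
    simp only [trace_sub, h3]
    ring
  let d : Fin N → ℝ := fun i => if L ≤ (i : ℕ) then 0 else 1
  let P := U * diagonal d * Uᵀ
  have hres : ((Φ - P * Φ) * (Φ - P * Φ)ᵀ).trace =
      ∑ i : Fin N, if L ≤ (i : ℕ) then σ i ^ 2 else 0 := by
    have hP : Φ - P * Φ = U * diagonal (1 - d) * Uᵀ * Φ := by
      have : diagonal (1 - d) = 1 - diagonal d := by
        rw [← diagonal_one, diagonal_sub]; rfl
      rw [this, Matrix.mul_sub, Matrix.sub_mul, Matrix.sub_mul, Matrix.mul_one, hU.1,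
        Matrix.one_mul]
    have hX : (Φ - P * Φ) * (Φ - P * Φ)ᵀ =
        U * (diagonal (1 - d) * diagonal (fun i => σ i ^ 2) * diagonal (1 - d)) * Uᵀ := by
      calc _ = U * diagonal (1 - d) * Uᵀ * (Φ * Φᵀ) * U * diagonal (1 - d) * Uᵀ := by
            rw [hP]
            simp only [transpose_mul, transpose_transpose, diagonal_transpose, Matrix.mul_assoc]
        _ = U * diagonal (1 - d) * (Uᵀ * U) * diagonal (fun i => σ i ^ 2) * (Uᵀ * U) *
              diagonal (1 - d) * Uᵀ := by
            rw [hdiag]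
            simp only [Matrix.mul_assoc]
        _ = _ := by
            rw [hU.2]
            simp only [Matrix.mul_assoc, Matrix.one_mul]
    rw [hX, trace_mul_comm, ← Matrix.mul_assoc, hU.2, Matrix.one_mul, diagonal_mul_diagonal,
      diagonal_mul_diagonal, trace_diagonal]
    refine Finset.sum_congr rfl fun i _ => ?_
    by_cases h : L ≤ (i : ℕ) <;> simp [d, h]
  refine ⟨P * Φ * S⁻¹, ?_, fun A' hA' => ?_, ?_⟩
  · have hd : (diagonal d).rank ≤ L := by
      rw [rank_diagonal, Fintype.card_subtype]
      have h : (Finset.univ.filter fun i => d i ≠ 0) =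
          Finset.univ.filter fun i : Fin N => (i : ℕ) < L := by
        ext i
        simp [d]
      rw [h, Fin.card_filter_val_lt]
      exact min_le_right _ _
    calc _ ≤ (U * diagonal d * Uᵀ).rank := (rank_mul_le_left _ _).trans (rank_mul_le_left _ _)
      _ ≤ (diagonal d).rank := (rank_mul_le_left _ _).trans (rank_mul_le_right _ _)
      _ ≤ L := hd
  · rw [hJF, hJF, nonsing_inv_mul_cancel_right _ _ hSu, hres]
    gcongr
    exact sum_tail_le_trace_sub (fun i => sq_nonneg (σ i))
      (fun i j hij => pow_le_pow_left₀ (hσ j) (hdec i j hij) 2) hU.1 hdiag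
      ((rank_mul_le_left _ _).trans hA')
  · have hA : CXY * CY⁻¹ - P * Φ * S⁻¹ = (Φ - P * Φ) * S⁻¹ := by
      rw [Matrix.sub_mul, ← hSS, Matrix.mul_inv_rev, hΦ, ← Matrix.mul_assoc]
    have htail : ∀ i : Fin N, 0 ≤ if L ≤ (i : ℕ) then σ i else 0 := fun i => by
      split_ifs
      exacts [hσ i, le_rfl]
    rw [hA]
    refine (opNorm_mul_le _ _).trans (mul_le_mul_of_nonneg_right ?_ (opNorm_nonneg _))
    refine opNorm_le_of_trace_le _ (Finset.sum_nonneg fun i _ => htail i) ?_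
    rw [hres]
    refine le_trans (le_of_eq ?_) (Finset.sum_sq_le_sq_sum_of_nonneg fun i _ => htail i)
    exact Finset.sum_congr rfl fun i _ => by split_ifs <;> simp
end

section
/- Well-conditioning of the JPC inverse: suppose the Y-block Σ_Y of Σ_Z is positive definite with smallest eigenvalue at least 1/K (K > 0), and suppose δ := ‖V_YLᵀ·V_YL − I_L‖ < 1 (operator norm), where V_YL ∈ ℝ^{M×L} is the matrix with columns y_1,…,y_L. Then V_YLᵀ·Σ_Y·V_YL is positive definite and ‖(V_YLᵀ·Σ_Y·V_YL)⁻¹‖ ≤ K/(1−δ). -/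
open Matrix

theorem dotProduct_self_eq_norm_toLp_sq {n : Type*} [Fintype n] (u : n → ℝ) :
    u ⬝ᵥ u = ‖WithLp.toLp 2 u‖ ^ 2 := by
  rw [EuclideanSpace.real_norm_sq_eq]
  simp [dotProduct, sq]

theorem dotProduct_le_norm_toLp_mul_norm_toLp {n : Type*} [Fintype n] (u v : n → ℝ) :
    u ⬝ᵥ v ≤ ‖WithLp.toLp 2 u‖ * ‖WithLp.toLp 2 v‖ := by
  have h := real_inner_le_norm (WithLp.toLp 2 u) (WithLp.toLp 2 v)
  rw [EuclideanSpace.inner_eq_star_dotProduct] at h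
  simpa [dotProduct_comm u v] using h

theorem norm_toLp_mulVec_le_opNorm {m n : Type*} [Fintype m] [Fintype n] [DecidableEq n]
    (A : Matrix m n ℝ) (u : n → ℝ) :
    ‖WithLp.toLp 2 (A *ᵥ u)‖ ≤ opNorm A * ‖WithLp.toLp 2 u‖ :=
  (Matrix.toEuclideanLin A).toContinuousLinearMap.le_opNorm (WithLp.toLp 2 u)

theorem opNorm_le_bound {m n : Type*} [Fintype m] [Fintype n] [DecidableEq n]
    (A : Matrix m n ℝ) {C : ℝ} (hC : 0 ≤ C)
    (h : ∀ u : n → ℝ, ‖WithLp.toLp 2 (A *ᵥ u)‖ ≤ C * ‖WithLp.toLp 2 u‖) : opNorm A ≤ C :=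
  ContinuousLinearMap.opNorm_le_bound _ hC fun u => h u.ofLp

/-- The lower bound on the Gram quadratic form given by its distance to the identity. -/
theorem one_sub_opNorm_mul_dotProduct_self_le {m n : Type*} [Fintype m] [Fintype n]
    [DecidableEq n] (V : Matrix m n ℝ) (u : n → ℝ) :
    (1 - opNorm (Vᵀ * V - 1)) * (u ⬝ᵥ u) ≤ (V *ᵥ u) ⬝ᵥ (V *ᵥ u) := by
  have h := dotProduct_le_norm_toLp_mul_norm_toLp (-u) ((Vᵀ * V - 1) *ᵥ u)
  have h' := mul_le_mul_of_nonneg_left (norm_toLp_mulVec_le_opNorm (Vᵀ * V - 1) u)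
    (norm_nonneg (WithLp.toLp 2 u))
  have e : u ⬝ᵥ (Vᵀ * V) *ᵥ u = (V *ᵥ u) ⬝ᵥ (V *ᵥ u) := by
    rw [← mulVec_mulVec, dotProduct_mulVec, vecMul_transpose]
  rw [neg_dotProduct, WithLp.toLp_neg, norm_neg, sub_mulVec, dotProduct_sub, one_mulVec, e] at h
  rw [sub_mulVec, one_mulVec] at h'
  rw [dotProduct_self_eq_norm_toLp_sq u] at h ⊢
  linarith

theorem posDef_of_mul_dotProduct_self_le {n : Type*} [Fintype n] {A : Matrix n n ℝ}
    (hA : A.IsHermitian) {c : ℝ} (hc : 0 < c)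
    (h : ∀ u : n → ℝ, c * (u ⬝ᵥ u) ≤ u ⬝ᵥ A *ᵥ u) : A.PosDef := by
  refine .of_dotProduct_mulVec_pos hA fun u hu => ?_
  have hpos : 0 < u ⬝ᵥ u := by simpa using dotProduct_star_self_pos_iff.mpr hu
  simpa using (mul_pos hc hpos).trans_le (h u)

theorem opNorm_inv_le_of_mul_dotProduct_self_le {n : Type*} [Fintype n] [DecidableEq n]
    {A : Matrix n n ℝ} (hA : IsUnit A) {c : ℝ} (hc : 0 < c)
    (h : ∀ u : n → ℝ, c * (u ⬝ᵥ u) ≤ u ⬝ᵥ A *ᵥ u) : opNorm A⁻¹ ≤ c⁻¹ := by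
  refine opNorm_le_bound _ (inv_nonneg.mpr hc.le) fun v => ?_
  have hv := (h (A⁻¹ *ᵥ v)).trans
    (dotProduct_le_norm_toLp_mul_norm_toLp (A⁻¹ *ᵥ v) (A *ᵥ A⁻¹ *ᵥ v))
  rw [mulVec_mulVec, mul_nonsing_inv A ((isUnit_iff_isUnit_det A).mp hA), one_mulVec,
    dotProduct_self_eq_norm_toLp_sq] at hv
  rw [inv_mul_eq_div, le_div_iff₀ hc]
  rcases (norm_nonneg (WithLp.toLp 2 (A⁻¹ *ᵥ v))).eq_or_lt with h0 | h0
  · simp [← h0]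
  · exact le_of_mul_le_mul_left (by linarith) h0

theorem mul_dotProduct_self_le_of_posSemidef_sub_smul_one {n : Type*} [Fintype n]
    [DecidableEq n] {A : Matrix n n ℝ} {c : ℝ} (h : (A - c • (1 : Matrix n n ℝ)).PosSemidef)
    (u : n → ℝ) : c * (u ⬝ᵥ u) ≤ u ⬝ᵥ A *ᵥ u := by
  simpa [sub_mulVec, smul_mulVec] using h.dotProduct_mulVec_nonneg u

/-- Well-conditioning of the JPC inverse: if the Y-block `Σ_Y` of `Σ_Z` is positive definite
with smallest eigenvalue at least `1/K`, and `δ = ‖V_YLᵀ V_YL − I_L‖ < 1`, then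
`V_YLᵀ Σ_Y V_YL` is positive definite and `‖(V_YLᵀ Σ_Y V_YL)⁻¹‖ ≤ K/(1−δ)`. -/
theorem jpc_inverse_well_conditioned
    (N M L : ℕ) (hL : L ≤ N + M)
    (s : Fin (N + M) → ℝ) (hs0 : ∀ i, 0 ≤ s i)
    (hdec : ∀ i j : Fin (N + M), i ≤ j → s j ≤ s i)
    (x : Fin (N + M) → Fin N → ℝ) (y : Fin (N + M) → Fin M → ℝ)
    (horth : ∀ i j, x i ⬝ᵥ x j + y i ⬝ᵥ y j = if i = j then (1 : ℝ) else 0)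
    (CY : Matrix (Fin M) (Fin M) ℝ)
    (hCY : CY = ∑ i : Fin (N + M), s i • Matrix.vecMulVec (y i) (y i))
    (VYL : Matrix (Fin M) (Fin L) ℝ)
    (hVYL : VYL = Matrix.of fun (m : Fin M) (l : Fin L) => y (Fin.castLE hL l) m)
    (K : ℝ) (hK : 0 < K)
    (hCYpd : CY.PosDef)
    (hmin : (CY - K⁻¹ • (1 : Matrix (Fin M) (Fin M) ℝ)).PosSemidef)
    (δ : ℝ) (hδdef : δ = opNorm (VYLᵀ * VYL - 1)) (hδ : δ < 1) :
    (VYLᵀ * CY * VYL).PosDef ∧ opNorm ((VYLᵀ * CY * VYL)⁻¹) ≤ K / (1 - δ) := by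
  have hbound : ∀ u : Fin L → ℝ,
      ((1 - δ) / K) * (u ⬝ᵥ u) ≤ u ⬝ᵥ (VYLᵀ * CY * VYL) *ᵥ u := fun u => by
    have e : u ⬝ᵥ (VYLᵀ * CY * VYL) *ᵥ u = (VYL *ᵥ u) ⬝ᵥ CY *ᵥ (VYL *ᵥ u) := by
      rw [← mulVec_mulVec, ← mulVec_mulVec, dotProduct_mulVec, vecMul_transpose]
    have hgram := one_sub_opNorm_mul_dotProduct_self_le VYL u
    rw [← hδdef] at hgram
    calc (1 - δ) / K * (u ⬝ᵥ u) = K⁻¹ * ((1 - δ) * (u ⬝ᵥ u)) := by ring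
      _ ≤ K⁻¹ * ((VYL *ᵥ u) ⬝ᵥ (VYL *ᵥ u)) := by gcongr
      _ ≤ (VYL *ᵥ u) ⬝ᵥ CY *ᵥ (VYL *ᵥ u) :=
        mul_dotProduct_self_le_of_posSemidef_sub_smul_one hmin _
      _ = _ := e.symm
  have hc : 0 < (1 - δ) / K := div_pos (by linarith) hK
  have hpd : (VYLᵀ * CY * VYL).PosDef :=
    posDef_of_mul_dotProduct_self_le
      (by simpa using isHermitian_conjTranspose_mul_mul VYL hCYpd.isHermitian) hc hbound
  exact ⟨hpd, by simpa using opNorm_inv_le_of_mul_dotProduct_self_le hpd.isUnit hc hbound⟩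
end

section
/- Asymptotic optimality of the JPC filter: for all K, T > 0 there exists C > 0 such that for all N, M, L ∈ ℕ with L ≤ N+M and all symmetric positive semidefinite Σ_Z ∈ ℝ^{(N+M)×(N+M)} with spectral data as in the context, if ‖Σ_Z‖ ≤ T, the Y-block Σ_Y is positive definite with ‖Σ_Y⁻¹‖ ≤ K, and δ := ‖V_YLᵀ·V_YL − I_L‖ ≤ 1/2, then V_YLᵀ·Σ_Y·V_YL is invertible and the JPC filter A_JPC := Σ_XY·V_YL·(V_YLᵀ·Σ_Y·V_YL)⁻¹·V_YLᵀ satisfies ‖Σ_XY·Σ_Y⁻¹ − A_JPC‖ ≤ C·(ρ_L + √δ), where ‖·‖ is the operator norm and ρ_L := Σ_{i>L} s_i. -/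
open Matrix

open scoped Matrix.Norms.L2Operator MatrixOrder

lemma opNorm_eq_norm {m n : Type*} [Fintype m] [Fintype n] [DecidableEq n]
    (A : Matrix m n ℝ) : opNorm A = ‖A‖ := rfl

lemma Matrix.l2_opNorm_transpose {m n : Type*} [Fintype m] [Fintype n] [DecidableEq m]
    [DecidableEq n] (A : Matrix m n ℝ) : ‖Aᵀ‖ = ‖A‖ := by
  rw [← conjTranspose_eq_transpose_of_trivial, l2_opNorm_conjTranspose]

lemma Matrix.l2_opNorm_transpose_mul_self {m n : Type*} [Fintype m] [Fintype n]
    [DecidableEq n] (A : Matrix m n ℝ) : ‖Aᵀ * A‖ = ‖A‖ * ‖A‖ := by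
  rw [← conjTranspose_eq_transpose_of_trivial, l2_opNorm_conjTranspose_mul_self]

lemma Matrix.l2_opNorm_one_le {n : Type*} [Fintype n] [DecidableEq n] :
    ‖(1 : Matrix n n ℝ)‖ ≤ 1 := by
  have h := l2_opNorm_transpose_mul_self (1 : Matrix n n ℝ)
  rw [transpose_one, one_mul] at h
  nlinarith [norm_nonneg (1 : Matrix n n ℝ)]

/-- A symmetric idempotent matrix has operator norm at most one. -/
lemma Matrix.l2_opNorm_le_one_of_transpose_mul_self {n : Type*} [Fintype n] [DecidableEq n]
    {Q : Matrix n n ℝ} (h : Qᵀ * Q = Q) : ‖Q‖ ≤ 1 := by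
  have h' := l2_opNorm_transpose_mul_self Q
  rw [h] at h'
  nlinarith [norm_nonneg Q]

lemma Matrix.l2_opNorm_replicateCol_le_one {m : Type*} [Fintype m]
    {a : m → ℝ} (ha : a ⬝ᵥ a ≤ 1) : ‖replicateCol Unit a‖ ≤ 1 := by
  have h := l2_opNorm_transpose_mul_self (replicateCol Unit a)
  have h0 : 0 ≤ a ⬝ᵥ a := Finset.sum_nonneg fun i _ => mul_self_nonneg (a i)
  have h1 : (replicateCol Unit a)ᵀ * replicateCol Unit a = (a ⬝ᵥ a) • 1 := by
    ext i j
    simp [Matrix.mul_apply, dotProduct]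
  rw [h1, norm_smul, Real.norm_of_nonneg h0] at h
  have h2 := l2_opNorm_one_le (n := Unit)
  nlinarith [norm_nonneg (replicateCol Unit a), norm_nonneg (1 : Matrix Unit Unit ℝ)]

lemma Matrix.l2_opNorm_vecMulVec_le_one {m n : Type*} [Fintype m] [Fintype n]
    [DecidableEq m] [DecidableEq n]
    {a : m → ℝ} {b : n → ℝ} (ha : a ⬝ᵥ a ≤ 1) (hb : b ⬝ᵥ b ≤ 1) : ‖vecMulVec a b‖ ≤ 1 := by
  rw [vecMulVec_eq Unit, ← transpose_replicateCol]
  refine (l2_opNorm_mul _ _).trans ?_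
  rw [l2_opNorm_transpose]
  exact mul_le_one₀ (l2_opNorm_replicateCol_le_one ha) (norm_nonneg _)
    (l2_opNorm_replicateCol_le_one hb)

lemma Fin.sum_eq_sum_castLE_add {n L : ℕ} (hL : L ≤ n) (f : Fin n → ℝ) :
    ∑ i, f i = ∑ l, f (Fin.castLE hL l) + ∑ i : Fin n, if L ≤ (i : ℕ) then f i else 0 := by
  obtain ⟨k, rfl⟩ := Nat.exists_eq_add_of_le hL
  rw [Fin.sum_univ_add, Fin.sum_univ_add (fun i => if L ≤ (i : ℕ) then f i else 0)]
  have h : ∀ i : Fin L, ¬ L ≤ (i : ℕ) := fun i => not_le.2 i.isLt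
  simp [Fin.castLE, Fin.castAdd, h]

/-- Splitting a weighted sum of rank-one matrices into its first `L` terms and a remainder. -/
lemma Matrix.sum_smul_vecMulVec_eq {p q : Type*} {n L : ℕ} (hL : L ≤ n)
    (s : Fin n → ℝ) (a : Fin n → p → ℝ) (b : Fin n → q → ℝ) :
    ∑ i, s i • vecMulVec (a i) (b i) =
      (of fun m (l : Fin L) => a (Fin.castLE hL l) m) *
        diagonal (fun l => s (Fin.castLE hL l)) *
        (of fun m (l : Fin L) => b (Fin.castLE hL l) m)ᵀ +
      ∑ i : Fin n, (if L ≤ (i : ℕ) then s i else 0) • vecMulVec (a i) (b i) := by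
  ext j k
  rw [Matrix.add_apply, Matrix.mul_apply]
  simp only [Matrix.sum_apply, Matrix.smul_apply, mul_diagonal, of_apply, transpose_apply,
    vecMulVec_apply, smul_eq_mul]
  rw [Fin.sum_eq_sum_castLE_add hL]
  congr 1
  · exact Finset.sum_congr rfl fun l _ => by ring
  · exact Finset.sum_congr rfl fun i _ => by split_ifs <;> simp

lemma Matrix.l2_opNorm_sum_smul_vecMulVec_le {ι p q : Type*} [Fintype ι] [Fintype p] [Fintype q]
    [DecidableEq p] [DecidableEq q]
    (r : ι → ℝ) (hr : ∀ i, 0 ≤ r i) (a : ι → p → ℝ) (b : ι → q → ℝ)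
    (ha : ∀ i, a i ⬝ᵥ a i ≤ 1) (hb : ∀ i, b i ⬝ᵥ b i ≤ 1) :
    ‖∑ i, r i • vecMulVec (a i) (b i)‖ ≤ ∑ i, r i := by
  refine norm_sum_le_of_le _ fun i _ => ?_
  rw [norm_smul, Real.norm_of_nonneg (hr i)]
  exact mul_le_of_le_one_right (hr i) (l2_opNorm_vecMulVec_le_one (ha i) (hb i))

lemma Matrix.PosDef.isUnit_det_transpose_mul_mul {m l : Type*} [Fintype m] [Fintype l]
    [DecidableEq l] {C : Matrix m m ℝ} (hC : C.PosDef)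
    {V : Matrix m l ℝ} (hV : ‖Vᵀ * V - 1‖ < 1) : IsUnit (Vᵀ * C * V).det := by
  have hG : IsUnit (Vᵀ * V) := by
    have h := isUnit_one_sub_of_norm_lt_one (x := 1 - Vᵀ * V) (by rwa [norm_sub_rev])
    rwa [sub_sub_cancel] at h
  have hinj : Function.Injective V.mulVec := fun u w huw =>
    mulVec_injective_of_isUnit hG <| by
      simp only [← mulVec_mulVec] at huw ⊢
      exact congrArg _ huw
  have h := (hC.conjTranspose_mul_mul_same hinj).isUnit
  rw [conjTranspose_eq_transpose_of_trivial] at h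
  exact (isUnit_iff_isUnit_det _).1 h

/-- If `D` is symmetric with `D C D = D` then `‖D‖ ≤ ‖C⁻¹‖`. -/
lemma Matrix.PosDef.l2_opNorm_le_of_mul_mul_eq {m : Type*} [Fintype m] [DecidableEq m]
    {C D : Matrix m m ℝ} (hC : C.PosDef) (hD : Dᵀ = D) (h : D * C * D = D) :
    ‖D‖ ≤ ‖C⁻¹‖ := by
  obtain ⟨B, hB⟩ : ∃ B : Matrix m m ℝ, C = Bᵀ * B := by
    obtain ⟨B, hB⟩ := CStarAlgebra.nonneg_iff_eq_star_mul_self.mp hC.posSemidef.nonneg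
    exact ⟨B, by rw [hB, star_eq_conjTranspose, conjTranspose_eq_transpose_of_trivial]⟩
  have hBdet : IsUnit B.det := by
    have hC' := (isUnit_iff_isUnit_det _).1 hC.isUnit
    rw [hB, det_mul] at hC'
    exact isUnit_of_mul_isUnit_right hC'
  have hBt : IsUnit Bᵀ.det := by rwa [det_transpose]
  have hQ : ‖B * D * Bᵀ‖ ≤ 1 := by
    apply l2_opNorm_le_one_of_transpose_mul_self
    rw [transpose_mul, transpose_mul, transpose_transpose, hD]
    calc B * (D * Bᵀ) * (B * D * Bᵀ) = B * (D * (Bᵀ * B) * D) * Bᵀ := by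
          simp only [Matrix.mul_assoc]
      _ = B * D * Bᵀ := by rw [← hB, h]
  have hDe : D = B⁻¹ * (B * D * Bᵀ) * B⁻¹ᵀ := by
    rw [transpose_nonsing_inv, ← Matrix.mul_assoc, ← Matrix.mul_assoc,
      nonsing_inv_mul _ hBdet, Matrix.one_mul, mul_nonsing_inv_cancel_right _ _ hBt]
  have hCn : ‖C⁻¹‖ = ‖B⁻¹‖ * ‖B⁻¹‖ := by
    have h' := l2_opNorm_transpose_mul_self (B⁻¹ᵀ)
    rwa [transpose_transpose, transpose_nonsing_inv, ← mul_inv_rev, ← hB,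
      ← transpose_nonsing_inv, l2_opNorm_transpose] at h'
  rw [hCn]
  calc ‖D‖ = ‖B⁻¹ * (B * D * Bᵀ) * B⁻¹ᵀ‖ := congrArg _ hDe
    _ ≤ ‖B⁻¹‖ * ‖B * D * Bᵀ‖ * ‖B⁻¹ᵀ‖ :=
      (l2_opNorm_mul _ _).trans (by gcongr; exact l2_opNorm_mul _ _)
    _ ≤ ‖B⁻¹‖ * 1 * ‖B⁻¹‖ := by rw [l2_opNorm_transpose]; gcongr
    _ = ‖B⁻¹‖ * ‖B⁻¹‖ := by ring

/-- The error `C⁻¹ - V (Vᵀ C V)⁻¹ Vᵀ` of the Galerkin approximation of `C⁻¹` has norm at most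
`‖C⁻¹‖`. -/
lemma Matrix.PosDef.l2_opNorm_inv_sub_le {m l : Type*} [Fintype m] [Fintype l] [DecidableEq m]
    [DecidableEq l] {C : Matrix m m ℝ} (hC : C.PosDef) {V : Matrix m l ℝ}
    (hV : IsUnit (Vᵀ * C * V).det) :
    ‖C⁻¹ - V * (Vᵀ * C * V)⁻¹ * Vᵀ‖ ≤ ‖C⁻¹‖ := by
  have hCdet := (isUnit_iff_isUnit_det _).1 hC.isUnit
  have hCt : Cᵀ = C := by
    rw [← conjTranspose_eq_transpose_of_trivial]
    exact hC.isHermitian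
  refine hC.l2_opNorm_le_of_mul_mul_eq ?_ ?_
  · simp only [transpose_sub, transpose_mul, transpose_nonsing_inv, transpose_transpose, hCt,
      Matrix.mul_assoc]
  · have hP : V * (Vᵀ * C * V)⁻¹ * Vᵀ * C * (V * (Vᵀ * C * V)⁻¹ * Vᵀ) =
        V * (Vᵀ * C * V)⁻¹ * Vᵀ := by
      calc _ = V * ((Vᵀ * C * V)⁻¹ * (Vᵀ * C * V)) * (Vᵀ * C * V)⁻¹ * Vᵀ := by
            simp only [Matrix.mul_assoc]
        _ = _ := by rw [nonsing_inv_mul _ hV, Matrix.mul_one]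
    rw [Matrix.sub_mul C⁻¹, nonsing_inv_mul _ hCdet, Matrix.sub_mul, Matrix.one_mul,
      Matrix.mul_sub, hP, mul_nonsing_inv_cancel_right _ _ hCdet, sub_self, sub_zero]

lemma Matrix.transpose_mul_mul_inv_sub {m l : Type*} [Fintype m] [Fintype l] [DecidableEq m]
    [DecidableEq l] {C : Matrix m m ℝ} (hC : IsUnit C.det) {V : Matrix m l ℝ}
    (hV : IsUnit (Vᵀ * C * V).det) :
    Vᵀ * C * (C⁻¹ - V * (Vᵀ * C * V)⁻¹ * Vᵀ) = 0 := by
  rw [Matrix.mul_sub, mul_nonsing_inv_cancel_right _ _ hC, ← Matrix.mul_assoc,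
    ← Matrix.mul_assoc, mul_nonsing_inv _ hV, Matrix.one_mul, sub_self]

lemma Matrix.l2_opNorm_le_two_mul_of_mul_add_eq_zero {l m : Type*} [Fintype l] [Fintype m]
    [DecidableEq l] [DecidableEq m] {G : Matrix l l ℝ} {W E : Matrix l m ℝ}
    (hG : ‖G - 1‖ ≤ 1 / 2) (h : G * W + E = 0) : ‖W‖ ≤ 2 * ‖E‖ := by
  have hW : W = -((G - 1) * W) - E := by
    rw [Matrix.sub_mul, Matrix.one_mul, eq_neg_of_add_eq_zero_left h]
    abel
  have h1 : ‖W‖ ≤ ‖(G - 1) * W‖ + ‖E‖ := by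
    calc ‖W‖ = ‖-((G - 1) * W) - E‖ := congrArg _ hW
      _ ≤ _ := (norm_sub_le _ _).trans (by rw [norm_neg])
  have h2 : ‖(G - 1) * W‖ ≤ 1 / 2 * ‖W‖ := (l2_opNorm_mul _ _).trans (by gcongr)
  linarith

/-- Asymptotic optimality of the JPC filter: for all `K, T > 0` there is `C > 0` such that for
all spectral data with `‖Σ_Z‖ ≤ T`, `Σ_Y` positive definite with `‖Σ_Y⁻¹‖ ≤ K`, and
`δ = ‖V_YLᵀ V_YL − I_L‖ ≤ 1/2`, the matrix `V_YLᵀ Σ_Y V_YL` is invertible and the JPC filter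
`A_JPC = Σ_XY V_YL (V_YLᵀ Σ_Y V_YL)⁻¹ V_YLᵀ` satisfies
`‖Σ_XY Σ_Y⁻¹ − A_JPC‖ ≤ C (ρ_L + √δ)` with `ρ_L = ∑_{i>L} sᵢ`. -/
theorem jpc_asymptotic_optimality :
    ∀ K T : ℝ, 0 < K → 0 < T →
    ∃ C : ℝ, 0 < C ∧
      ∀ (N M L : ℕ),
      ∀ (s : Fin (N + M) → ℝ), (∀ i, 0 ≤ s i) →
      (∀ i j : Fin (N + M), i ≤ j → s j ≤ s i) →
      ∀ (x : Fin (N + M) → Fin N → ℝ) (y : Fin (N + M) → Fin M → ℝ),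
      (∀ i j, x i ⬝ᵥ x j + y i ⬝ᵥ y j = if i = j then (1 : ℝ) else 0) →
      ∀ (hL : L ≤ N + M)
        (CXY : Matrix (Fin N) (Fin M) ℝ)
        (_ : CXY = ∑ i : Fin (N + M), s i • Matrix.vecMulVec (x i) (y i))
        (CY : Matrix (Fin M) (Fin M) ℝ)
        (_ : CY = ∑ i : Fin (N + M), s i • Matrix.vecMulVec (y i) (y i))
        (VYL : Matrix (Fin M) (Fin L) ℝ)
        (_ : VYL = Matrix.of fun (m : Fin M) (l : Fin L) => y (Fin.castLE hL l) m),
      opNorm (∑ i : Fin (N + M),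
          s i • Matrix.vecMulVec (Sum.elim (x i) (y i)) (Sum.elim (x i) (y i))) ≤ T →
      CY.PosDef →
      opNorm CY⁻¹ ≤ K →
      opNorm (VYLᵀ * VYL - 1) ≤ 1 / 2 →
      IsUnit (VYLᵀ * CY * VYL).det ∧
      opNorm (CXY * CY⁻¹ - CXY * VYL * (VYLᵀ * CY * VYL)⁻¹ * VYLᵀ)
        ≤ C * ((∑ i : Fin (N + M), if L ≤ (i : ℕ) then s i else 0)
            + Real.sqrt (opNorm (VYLᵀ * VYL - 1))) := by
  intro K T hK _
  refine ⟨5 * K, by positivity, ?_⟩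
  intro N M L s hs _ x y hxy hL CXY hCXY CY hCY VYL hVYL _ hpos hinv hδ
  simp only [opNorm_eq_norm] at *
  have hunit := hpos.isUnit_det_transpose_mul_mul (V := VYL) (by linarith)
  refine ⟨hunit, ?_⟩
  have hx1 : ∀ i, x i ⬝ᵥ x i ≤ 1 := fun i => by
    have h := hxy i i
    have h' : 0 ≤ y i ⬝ᵥ y i := Finset.sum_nonneg fun j _ => mul_self_nonneg (y i j)
    rw [if_pos rfl] at h
    linarith
  have hy1 : ∀ i, y i ⬝ᵥ y i ≤ 1 := fun i => by
    have h := hxy i i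
    have h' : 0 ≤ x i ⬝ᵥ x i := Finset.sum_nonneg fun j _ => mul_self_nonneg (x i j)
    rw [if_pos rfl] at h
    linarith
  set ρ : ℝ := ∑ i : Fin (N + M), if L ≤ (i : ℕ) then s i else 0 with hρ
  have hr : ∀ i : Fin (N + M), 0 ≤ if L ≤ (i : ℕ) then s i else 0 := fun i => by
    split_ifs
    exacts [hs i, le_rfl]
  have hρ0 : 0 ≤ ρ := Finset.sum_nonneg fun i _ => hr i
  have hRX := l2_opNorm_sum_smul_vecMulVec_le _ hr x y hx1 hy1
  have hRY := l2_opNorm_sum_smul_vecMulVec_le _ hr y y hy1 hy1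
  rw [sum_smul_vecMulVec_eq hL, ← hVYL] at hCXY hCY
  rw [← hρ] at hRX hRY
  set RX := ∑ i : Fin (N + M), (if L ≤ (i : ℕ) then s i else 0) • vecMulVec (x i) (y i)
  set RY := ∑ i : Fin (N + M), (if L ≤ (i : ℕ) then s i else 0) • vecMulVec (y i) (y i)
  set S := diagonal fun l : Fin L => s (Fin.castLE hL l)
  set X : Matrix (Fin N) (Fin L) ℝ := of fun m l => x (Fin.castLE hL l) m with hX
  have hgram : Xᵀ * X = 1 - VYLᵀ * VYL := by
    rw [eq_sub_iff_add_eq, hVYL, hX]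
    ext i j
    have h := hxy (Fin.castLE hL i) (Fin.castLE hL j)
    simpa [Matrix.mul_apply, Matrix.one_apply, dotProduct] using h
  have hXn : ‖X‖ ≤ 1 := by
    have h := l2_opNorm_transpose_mul_self X
    rw [hgram, norm_sub_rev] at h
    nlinarith [norm_nonneg X]
  have hVn : ‖VYLᵀ‖ ≤ 2 := by
    have h := l2_opNorm_transpose_mul_self VYL
    have h1 := norm_add_le (VYLᵀ * VYL - 1) 1
    rw [sub_add_cancel] at h1
    have h2 := l2_opNorm_one_le (n := Fin L)
    rw [l2_opNorm_transpose]
    nlinarith [norm_nonneg VYL]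
  have hDn : ‖CY⁻¹ - VYL * (VYLᵀ * CY * VYL)⁻¹ * VYLᵀ‖ ≤ K :=
    (hpos.l2_opNorm_inv_sub_le hunit).trans hinv
  have hVCD := transpose_mul_mul_inv_sub ((isUnit_iff_isUnit_det _).1 hpos.isUnit) hunit
  have hdiff : CXY * CY⁻¹ - CXY * VYL * (VYLᵀ * CY * VYL)⁻¹ * VYLᵀ =
      CXY * (CY⁻¹ - VYL * (VYLᵀ * CY * VYL)⁻¹ * VYLᵀ) := by
    simp only [Matrix.mul_sub, Matrix.mul_assoc]
  rw [hdiff]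
  set D := CY⁻¹ - VYL * (VYLᵀ * CY * VYL)⁻¹ * VYLᵀ
  have hW : ‖S * VYLᵀ * D‖ ≤ 2 * ‖VYLᵀ * RY * D‖ := by
    refine l2_opNorm_le_two_mul_of_mul_add_eq_zero hδ ?_
    rw [← hVCD]
    conv_rhs => rw [hCY]
    simp only [Matrix.mul_add, Matrix.add_mul, Matrix.mul_assoc]
  have hE : ‖VYLᵀ * RY * D‖ ≤ 2 * ρ * K :=
    (l2_opNorm_mul _ _).trans <| by
      gcongr
      exact (l2_opNorm_mul _ _).trans (by gcongr)
  have hmain : ‖CXY * D‖ ≤ 5 * K * ρ := by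
    have h : CXY * D = X * (S * VYLᵀ * D) + RX * D := by
      rw [hCXY]
      simp only [Matrix.add_mul, Matrix.mul_assoc]
    have h1 : ‖X * (S * VYLᵀ * D)‖ ≤ 1 * ‖S * VYLᵀ * D‖ :=
      (l2_opNorm_mul _ _).trans (by gcongr)
    have h2 : ‖RX * D‖ ≤ ρ * K := (l2_opNorm_mul _ _).trans (by gcongr)
    rw [h]
    linarith [norm_add_le (X * (S * VYLᵀ * D)) (RX * D)]
  refine hmain.trans ?_
  gcongr
  exact le_add_of_nonneg_right (Real.sqrt_nonneg _)
end
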